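/- arXiv:1812.01100 — 3 statements merged into one kernel-verified Lean document; each statement's English description precedes it below -/
import Mathlib

section
/- Let K be any field and S = K[x1,x2,x3,x4]. For every 8-dimensional K-subspace W of the space S_2 of quadratic forms, the subspace W^2 of S_4 spanned by products of pairs of elements of W has dimension at most 34. In particular dim W^2 < min(dim S_4, C(9,2)) = 35. -/
open MvPolynomial

/-- The exponents of the monomials of degree `n` in four variables. -/
abbrev Exponents (n : ℕ) : Type := {d : Fin 4 →₀ ℕ // d.degree = n}

/-- Monomials of degree `n` correspond to multisets of `n` variables. -/
noncomputable def exponentsEquivSym (n : ℕ) : Exponents n ≃ Sym (Fin 4) n :=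
  (Equiv.subtypeEquivRight fun _ => Iff.rfl).trans (Sym.equivNatSum (Fin 4) n).symm

noncomputable instance (n : ℕ) : Fintype (Exponents n) :=
  Fintype.ofEquiv _ (exponentsEquivSym n).symm

theorem card_exponents (n : ℕ) : Fintype.card (Exponents n) = Nat.multichoose 4 n := by
  rw [Fintype.card_congr (exponentsEquivSym n), Sym.card_sym_eq_multichoose, Fintype.card_fin]

theorem homogeneousSubmodule_eq_span_monomial (K : Type*) [Field K] (n : ℕ) :
    homogeneousSubmodule (Fin 4) K n =
      Submodule.span K (Set.range fun d : Exponents n => monomial (d : Fin 4 →₀ ℕ) (1 : K)) := by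
  apply le_antisymm
  · intro f hf
    rw [f.as_sum]
    refine Submodule.sum_mem _ fun d hd => ?_
    have hdeg : d.degree = n := by
      simpa [Finsupp.degree_apply] using (hf.degree_eq_sum_deg_support hd).symm
    rw [show monomial d (coeff d f) = coeff d f • monomial d (1 : K) by simp [smul_monomial]]
    exact Submodule.smul_mem _ _ (Submodule.subset_span ⟨⟨d, hdeg⟩, rfl⟩)
  · rw [Submodule.span_le]
    rintro _ ⟨d, rfl⟩
    exact isHomogeneous_monomial _ d.2

theorem finrank_homogeneousSubmodule (K : Type*) [Field K] (n : ℕ) :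
    Module.finrank K (homogeneousSubmodule (Fin 4) K n) = Nat.multichoose 4 n := by
  rw [homogeneousSubmodule_eq_span_monomial, finrank_span_eq_card, card_exponents]
  exact (basisMonomials (Fin 4) K).linearIndependent.comp _ Subtype.val_injective

/-- The quadratic monomial `X i * X j` attached to `s(i, j)`. -/
noncomputable def quadMonomial {R : Type*} [CommRing R] (k : Sym2 (Fin 4)) :
    MvPolynomial (Fin 4) R :=
  (k.map X).mul

theorem isHomogeneous_quadMonomial {R : Type*} [CommRing R] (k : Sym2 (Fin 4)) :
    (quadMonomial k : MvPolynomial (Fin 4) R).IsHomogeneous 2 := by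
  induction k with
  | _ i j => exact (isHomogeneous_X R i).mul (isHomogeneous_X R j)

theorem homogeneousSubmodule_two_eq_span (K : Type*) [Field K] :
    homogeneousSubmodule (Fin 4) K 2 = Submodule.span K (Set.range quadMonomial) := by
  apply le_antisymm
  · rw [← homogeneousSubmodule_one_pow, homogeneousSubmodule_one_eq_span_X, pow_two,
      Submodule.span_mul_span, Submodule.span_le]
    rintro _ ⟨_, ⟨i, rfl⟩, _, ⟨j, rfl⟩, rfl⟩
    exact Submodule.subset_span ⟨s(i, j), rfl⟩
  · rw [Submodule.span_le]
    rintro _ ⟨k, rfl⟩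
    exact isHomogeneous_quadMonomial k

/-- A quadric annihilated by the two functionals on quadrics whose values on monomials are `a` and
`b`; these span the common kernel when the `2 × 2` minor at `l`, `m` is invertible. -/
noncomputable def koszul {R : Type*} [CommRing R] (a b : Sym2 (Fin 4) → R)
    (l m k : Sym2 (Fin 4)) : MvPolynomial (Fin 4) R :=
  C (a l * b m - a m * b l) * quadMonomial k - C (a k * b m - a m * b k) * quadMonomial l
    + C (a k * b l - a l * b k) * quadMonomial m

theorem exists_le_span_koszul {K : Type*} [Field K] (W : Submodule K (MvPolynomial (Fin 4) K))
    (hW : W ≤ homogeneousSubmodule (Fin 4) K 2) (hdim : Module.finrank K W = 8) :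
    ∃ a b l m, W ≤ Submodule.span K (Set.range (koszul a b l m)) := by
  set S := homogeneousSubmodule (Fin 4) K 2
  have hS : Module.finrank K S = 10 := by
    rw [finrank_homogeneousSubmodule, Nat.multichoose_eq]
    rfl
  have : Module.Finite K S := Module.finite_of_finrank_pos (by omega)
  let V : Submodule K S := W.submoduleOf S
  have hV : Module.finrank K V = 8 := by
    rw [← hdim]
    exact (Submodule.submoduleOfEquivOfLe hW).finrank_eq
  have hQ : Module.finrank K (S ⧸ V) = 2 := by
    have := V.finrank_quotient_add_finrank
    omega
  let e : Sym2 (Fin 4) → S := fun k => ⟨quadMonomial k, isHomogeneous_quadMonomial k⟩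
  have he : Submodule.span K (Set.range e) = ⊤ := by
    apply Submodule.map_injective_of_injective S.injective_subtype
    rw [Submodule.map_span, ← Set.range_comp, Submodule.map_top, Submodule.range_subtype]
    exact (homogeneousSubmodule_two_eq_span K).symm
  have hg : Submodule.span K (Set.range (V.mkQ ∘ e)) = ⊤ := by
    rw [Set.range_comp, ← Submodule.map_span, he, Submodule.map_top, Submodule.range_mkQ]
  obtain ⟨f, hf, -, hli⟩ := Submodule.exists_fun_fin_finrank_span_eq K (Set.range (V.mkQ ∘ e))
  have hr : 2 = Module.finrank K (Submodule.span K (Set.range (V.mkQ ∘ e))) := by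
    rw [hg, finrank_top, hQ]
  let v := basisOfLinearIndependentOfCardEqFinrank
    (hli.comp (Fin.cast hr) (Fin.cast_injective hr)) (by simp [hQ])
  have hv : ∀ i, v i = f (Fin.cast hr i) := by simp [v]
  obtain ⟨l, hl⟩ := hf (Fin.cast hr 0)
  obtain ⟨m, hm⟩ := hf (Fin.cast hr 1)
  rw [← hv] at hl hm
  let c : Fin 2 → Sym2 (Fin 4) → K := fun i k => v.repr (V.mkQ (e k)) i
  have hcl : c 0 l = 1 ∧ c 1 l = 0 := by
    simp only [c, show V.mkQ (e l) = v 0 from hl]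
    simp
  have hcm : c 0 m = 0 ∧ c 1 m = 1 := by
    simp only [c, show V.mkQ (e m) = v 1 from hm]
    simp
  refine ⟨c 0, c 1, l, m, fun g hg => ?_⟩
  obtain ⟨t, ht⟩ := (Submodule.mem_span_range_iff_exists_fun K).1
    (he ▸ Submodule.mem_top : (⟨g, hW hg⟩ : S) ∈ Submodule.span K (Set.range e))
  have hc : ∀ i, ∑ k, t k * c i k = 0 := fun i => by
    have h0 : V.mkQ ⟨g, hW hg⟩ = 0 := (Submodule.Quotient.mk_eq_zero V).2 hg
    rw [← ht] at h0
    simpa [c] using congrArg (fun q => v.repr q i) h0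
  have hg' : g = ∑ k, t k • (quadMonomial k : MvPolynomial (Fin 4) K) := by
    simpa [e] using (congrArg S.subtype ht).symm
  refine (Submodule.mem_span_range_iff_exists_fun K).2 ⟨t, ?_⟩
  have hk : ∀ k, t k • koszul (c 0) (c 1) l m k = t k • quadMonomial k
      - C (t k * c 0 k) * quadMonomial l - C (t k * c 1 k) * quadMonomial m := fun k => by
    simp only [koszul, hcl, hcm, smul_eq_C_mul, map_mul, map_sub, map_one, map_zero]
    ring
  rw [Finset.sum_congr rfl fun k _ => hk k, Finset.sum_sub_distrib, Finset.sum_sub_distrib,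
    ← Finset.sum_mul, ← Finset.sum_mul, ← map_sum, ← map_sum, hc, hc, hg']
  simp

section
open Matrix

theorem exists_orthogonal_diagonalization {n : Type*} [Fintype n] [DecidableEq n]
    {A : Matrix n n ℝ} (hA : A.IsHermitian) :
    ∃ U : Matrix n n ℝ, U * Uᵀ = 1 ∧ A = U * diagonal hA.eigenvalues * Uᵀ :=
  ⟨hA.eigenvectorUnitary.1, Unitary.mul_star_self_of_mem hA.eigenvectorUnitary.2,
    hA.spectral_theorem.trans (Unitary.conjStarAlgAut_apply _ _)⟩

theorem exists_simultaneous_diagonalization {n : Type*} [Fintype n] [DecidableEq n]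
    {A B : Matrix n n ℝ} (hA : A.PosDef) (hB : B.IsSymm) :
    ∃ (P : Matrix n n ℝ) (D : n → ℝ), IsUnit P ∧ A = P * Pᵀ ∧ B = P * diagonal D * Pᵀ := by
  obtain ⟨Q, hQ, hAQ⟩ : ∃ Q : Matrix n n ℝ, IsUnit Q ∧ A = Q * Qᵀ := by
    obtain ⟨U, hU, h⟩ := exists_orthogonal_diagonalization hA.isHermitian
    have hpos := hA.eigenvalues_pos
    set d := hA.isHermitian.eigenvalues
    have hd : diagonal d = diagonal (fun i => √(d i)) * diagonal (fun i => √(d i)) := by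
      rw [diagonal_mul_diagonal]
      congr! 2 with i
      exact (Real.mul_self_sqrt (hpos i).le).symm
    have hAA : A = (U * diagonal fun i => √(d i)) * (U * diagonal fun i => √(d i))ᵀ := by
      rw [h, hd, transpose_mul, diagonal_transpose]
      simp only [Matrix.mul_assoc]
    refine ⟨_, ?_, hAA⟩
    rw [isUnit_iff_isUnit_det]
    have := (isUnit_iff_isUnit_det _).1 hA.isUnit
    rw [hAA, det_mul] at this
    exact isUnit_of_mul_isUnit_left this
  have hQd := (isUnit_iff_isUnit_det _).1 hQ
  have hC : (Q⁻¹ * B * Q⁻¹ᵀ).IsHermitian := by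
    simp [IsHermitian, hB.eq, Matrix.mul_assoc]
  obtain ⟨U, hU, h⟩ := exists_orthogonal_diagonalization hC
  refine ⟨Q * U, hC.eigenvalues, hQ.mul (IsUnit.of_mul_eq_one _ hU), ?_, ?_⟩
  · rw [hAQ, transpose_mul, Matrix.mul_assoc, ← Matrix.mul_assoc U, hU, Matrix.one_mul]
  · calc B = Q * (Q⁻¹ * B * Q⁻¹ᵀ) * Qᵀ := by
          rw [Matrix.mul_assoc, Matrix.mul_assoc _ _ Qᵀ, ← transpose_mul, mul_nonsing_inv _ hQd,
            transpose_one, Matrix.mul_one, ← Matrix.mul_assoc, mul_nonsing_inv _ hQd,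
            Matrix.one_mul]
      _ = Q * (U * diagonal hC.eigenvalues * Uᵀ) * Qᵀ := congrArg (Q * · * Qᵀ) h
      _ = _ := by rw [transpose_mul]; simp only [Matrix.mul_assoc]

theorem posDef_of_three_lt_diag_of_abs_le_one {A : Matrix (Fin 4) (Fin 4) ℝ} (hA : A.IsSymm)
    (hd : ∀ i, 3 < A i i) (ho : ∀ i j, i ≠ j → |A i j| ≤ 1) : A.PosDef := by
  rw [posDef_iff_dotProduct_mulVec]
  refine ⟨by simpa [IsHermitian, conjTranspose_eq_transpose_of_trivial] using hA.eq,
    fun x hx => ?_⟩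
  have key : ∀ i j, i ≠ j → 0 ≤ 2 * (A i j * (x i * x j)) + (x i ^ 2 + x j ^ 2) := fun i j hij => by
    obtain ⟨h1, h2⟩ := abs_le.1 (ho i j hij)
    nlinarith [mul_nonneg (sub_nonneg.2 h2) (sq_nonneg (x i - x j)),
      mul_nonneg (neg_le_iff_add_nonneg.1 h1) (sq_nonneg (x i + x j))]
  have hpos : 0 < ∑ i, (A i i - 3) * x i ^ 2 := by
    obtain ⟨i, hi⟩ := Function.ne_iff.1 hx
    refine Finset.sum_pos' (fun j _ => mul_nonneg (sub_nonneg.2 (hd j).le) (sq_nonneg _))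
      ⟨i, Finset.mem_univ i, mul_pos (sub_pos.2 (hd i)) (sq_pos_of_ne_zero hi)⟩
  have e10 := hA.apply 0 1
  have e20 := hA.apply 0 2
  have e30 := hA.apply 0 3
  have e21 := hA.apply 1 2
  have e31 := hA.apply 1 3
  have e32 := hA.apply 2 3
  simp only [Fin.sum_univ_four] at hpos
  simp only [dotProduct, mulVec, Fin.sum_univ_four, star_trivial, e10, e20, e30, e21, e31, e32]
  linarith [key 0 1 (by decide), key 0 2 (by decide), key 0 3 (by decide), key 1 2 (by decide),
    key 1 3 (by decide), key 2 3 (by decide)]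

/-- Vectors orthogonal to both `1` and `D` span a space of dimension at most two unless `D` is
constant, so some nonzero diagonal quadratic form on `ℝ⁴` vanishes on all of them. -/
theorem exists_weights (D : Fin 4 → ℝ) (ι : Type*) (u : ι → Fin 4 → ℝ)
    (h0 : ∀ k, ∑ i, u k i = 0) (h1 : ∀ k, ∑ i, D i * u k i = 0)
    (h2 : ∀ t, (∀ i, D i = t) → u = 0) :
    ∃ c : Fin 4 → ℝ, c ≠ 0 ∧ ∀ k k', ∑ i, c i * (u k i * u k' i) = 0 := by
  obtain ⟨r, s, hrs⟩ : ∃ r s : Fin 4 → ℝ, ∀ k, ∃ α β : ℝ, u k = α • r + β • s := by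
    by_cases hD : ∃ t, ∀ i, D i = t
    · obtain ⟨t, ht⟩ := hD
      exact ⟨0, 0, fun k => ⟨0, 0, by simp [h2 t ht]⟩⟩
    · let φ : (Fin 4 → ℝ) →ₗ[ℝ] (Fin 2 → ℝ) := (Matrix.of ![1, D]).mulVecLin
      have hφ : ∀ k, u k ∈ LinearMap.ker φ := fun k => by
        ext j
        fin_cases j
        · simpa [φ, mulVec, dotProduct] using h0 k
        · simpa [φ, mulVec, dotProduct] using h1 k
      have hli : LinearIndependent ℝ ![(1 : Fin 4 → ℝ), D] := by
        rw [LinearIndependent.pair_iff' one_ne_zero]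
        intro t ht
        exact hD ⟨t, fun i => by simp [← ht]⟩
      have hr : Module.finrank ℝ (LinearMap.range φ) = 2 := by
        have : (Matrix.of ![(1 : Fin 4 → ℝ), D]).rank = 2 := by
          simpa using LinearIndependent.rank_matrix (M := Matrix.of ![(1 : Fin 4 → ℝ), D]) hli
        exact this
      have hk : Module.finrank ℝ (LinearMap.ker φ) = 2 := by
        have := φ.finrank_range_add_finrank_ker
        simp at this
        omega
      let v := Module.finBasisOfFinrankEq ℝ _ hk
      refine ⟨v 0, v 1, fun k => ⟨v.repr ⟨u k, hφ k⟩ 0, v.repr ⟨u k, hφ k⟩ 1, ?_⟩⟩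
      have := congrArg Subtype.val (v.sum_repr ⟨u k, hφ k⟩)
      simpa only [Fin.sum_univ_two, Submodule.coe_add, Submodule.coe_smul] using this.symm
  let ψ : (Fin 4 → ℝ) →ₗ[ℝ] (Fin 3 → ℝ) := (Matrix.of ![r * r, r * s, s * s]).mulVecLin
  obtain ⟨c, hc, hc0⟩ := (Submodule.ne_bot_iff _).1
    (LinearMap.ker_ne_bot_of_finrank_lt (f := ψ) (by simp))
  refine ⟨c, hc0, fun k k' => ?_⟩
  have e0 := congrFun hc 0
  have e1 := congrFun hc 1
  have e2 := congrFun hc 2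
  simp [ψ, mulVec, dotProduct, Fin.sum_univ_four] at e0 e1 e2
  obtain ⟨α, β, h⟩ := hrs k
  obtain ⟨α', β', h'⟩ := hrs k'
  rw [h, h']
  simp [Fin.sum_univ_four]
  linear_combination α * α' * e0 + (α * β' + β * α') * e1 + β * β' * e2

end

/-- The coefficients of the linear combinations, given by `c`, of the products of the quadrics
`koszul a b l m k`. -/
noncomputable def productMatrix {R : Type*} [CommRing R] (a b : Sym2 (Fin 4) → R)
    (l m : Sym2 (Fin 4)) (c : Exponents 4 → Sym2 (Fin 4) × Sym2 (Fin 4) → R) :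
    Matrix (Exponents 4) (Exponents 4) R :=
  Matrix.of fun i j => coeff j.1 (∑ p, C (c i p) * (koszul a b l m p.1 * koszul a b l m p.2))

theorem map_koszul {R S : Type*} [CommRing R] [CommRing S] (φ : R →+* S)
    (a b : Sym2 (Fin 4) → R) (l m k : Sym2 (Fin 4)) :
    MvPolynomial.map φ (koszul a b l m k) = koszul (φ ∘ a) (φ ∘ b) l m k := by
  have h : ∀ k, MvPolynomial.map φ (quadMonomial k) = quadMonomial k := fun k => by
    induction k with
    | _ i j => simp [quadMonomial]
  simp [koszul, h]

theorem map_det_productMatrix {R S : Type*} [CommRing R] [CommRing S] (φ : R →+* S)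
    (a b : Sym2 (Fin 4) → R) (l m : Sym2 (Fin 4))
    (c : Exponents 4 → Sym2 (Fin 4) × Sym2 (Fin 4) → R) :
    φ (productMatrix a b l m c).det =
      (productMatrix (φ ∘ a) (φ ∘ b) l m fun i p => φ (c i p)).det := by
  rw [RingHom.map_det]
  congr 1
  ext i j
  simp [productMatrix, ← map_koszul, ← coeff_map]

theorem isHomogeneous_koszul {R : Type*} [CommRing R] (a b : Sym2 (Fin 4) → R)
    (l m k : Sym2 (Fin 4)) : (koszul a b l m k).IsHomogeneous 2 :=
  (((isHomogeneous_quadMonomial k).C_mul _).sub ((isHomogeneous_quadMonomial l).C_mul _)).add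
    ((isHomogeneous_quadMonomial m).C_mul _)

theorem sum_coeff_mul_monomial {R : Type*} [CommRing R] {n : ℕ} {f : MvPolynomial (Fin 4) R}
    (hf : f.IsHomogeneous n) :
    ∑ d : Exponents n, C (coeff d.1 f) * monomial d.1 1 = f := by
  ext e
  simp only [coeff_sum, coeff_C_mul, coeff_monomial]
  by_cases he : e.degree = n
  · rw [Finset.sum_eq_single ⟨e, he⟩]
    · simp
    · intro d _ hd
      rw [if_neg fun h => hd (Subtype.ext h), mul_zero]
    · simp
  · rw [hf.coeff_eq_zero he, Finset.sum_eq_zero]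
    intro d _
    rw [if_neg fun h : d.1 = e => he (h ▸ d.2), mul_zero]

theorem det_productMatrix_eq_zero_of_posDef (a b : Sym2 (Fin 4) → ℝ) (l m : Sym2 (Fin 4))
    (c : Exponents 4 → Sym2 (Fin 4) × Sym2 (Fin 4) → ℝ)
    (ha : (Matrix.of fun i j => a s(i, j)).PosDef) :
    (productMatrix a b l m c).det = 0 := by
  obtain ⟨P, D, hP, hA, hB⟩ := exists_simultaneous_diagonalization
    (B := Matrix.of fun i j => b s(i, j)) ha (by ext i j; simp [Sym2.eq_swap])
  have ha' : ∀ k, ∑ i, eval (fun x => P x i) (quadMonomial k) = a k := fun k => by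
    induction k with
    | _ x y => simpa [quadMonomial, Matrix.mul_apply] using (congrFun (congrFun hA x) y).symm
  have hb' : ∀ k, ∑ i, D i * eval (fun x => P x i) (quadMonomial k) = b k := fun k => by
    induction k with
    | _ x y =>
      have := (congrFun (congrFun hB x) y).symm
      simp only [Matrix.mul_apply (M := P * _), Matrix.mul_diagonal, Matrix.transpose_apply,
        Matrix.of_apply] at this
      rw [← this]
      refine Finset.sum_congr rfl fun i _ => ?_
      simp [quadMonomial]
      ring
  let u : Sym2 (Fin 4) → Fin 4 → ℝ := fun k i => eval (fun x => P x i) (koszul a b l m k)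
  have hu : ∀ k i, u k i = (a l * b m - a m * b l) * eval (fun x => P x i) (quadMonomial k)
      - (a k * b m - a m * b k) * eval (fun x => P x i) (quadMonomial l)
      + (a k * b l - a l * b k) * eval (fun x => P x i) (quadMonomial m) := fun k i => by
    simp [u, koszul]
  obtain ⟨w, hw, hwu⟩ := exists_weights D _ u
    (fun k => by
      simp only [hu, Finset.sum_add_distrib, Finset.sum_sub_distrib, ← Finset.mul_sum, ha']
      ring)
    (fun k => by
      simp only [hu, mul_add, mul_sub, mul_left_comm (D _), Finset.sum_add_distrib,
        Finset.sum_sub_distrib, ← Finset.mul_sum, hb']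
      ring)
    (fun t ht => by
      have hab : ∀ k, b k = t * a k := fun k => by
        rw [← hb', ← ha', Finset.mul_sum]
        simp [ht]
      ext k i
      rw [hu]
      simp only [hab, Pi.zero_apply]
      ring)
  let Λ : MvPolynomial (Fin 4) ℝ →ₗ[ℝ] ℝ := ∑ i, w i • (aeval fun x => P x i).toLinearMap
  have hΛ : ∀ f, Λ f = ∑ i, w i * eval (fun x => P x i) f := fun f => by
    simp [Λ, aeval_eq_eval]
  have hcoeff : ∀ f : MvPolynomial (Fin 4) ℝ, f.IsHomogeneous 4 →
      ∑ d : Exponents 4, coeff d.1 f * Λ (monomial d.1 1) = Λ f := fun f hf => by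
    conv_rhs => rw [← sum_coeff_mul_monomial hf]
    simp only [map_sum, ← smul_eq_C_mul, map_smul, smul_eq_mul]
  refine Matrix.exists_mulVec_eq_zero_iff.1 ⟨fun d => Λ (monomial d.1 1), fun h0 => hw ?_, ?_⟩
  · ext i
    have hPP : P⁻¹ * P = 1 := Matrix.nonsing_inv_mul _ ((Matrix.isUnit_iff_isUnit_det _).1 hP)
    let ℓ : MvPolynomial (Fin 4) ℝ := ∑ x, C (P⁻¹ i x) * X x
    have hℓ : (ℓ ^ 4).IsHomogeneous 4 :=
      (IsHomogeneous.sum _ _ 1 fun x _ => (isHomogeneous_X ℝ x).C_mul _).pow 4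
    have hev : ∀ j, eval (fun x => P x j) ℓ = (1 : Matrix _ _ ℝ) i j := fun j => by
      rw [← hPP, Matrix.mul_apply]
      simp [ℓ]
    have h := hcoeff _ hℓ
    rw [hΛ, Finset.sum_eq_zero fun d _ => by rw [congrFun h0 d, Pi.zero_apply, mul_zero]] at h
    simpa [hev, Matrix.one_apply] using h.symm
  · ext i
    simp only [Matrix.mulVec, dotProduct, productMatrix, Matrix.of_apply, Pi.zero_apply]
    rw [hcoeff _ (IsHomogeneous.sum _ _ _ fun p _ => ((isHomogeneous_koszul ..).mul
      (isHomogeneous_koszul ..)).C_mul _)]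
    simp only [map_sum, ← smul_eq_C_mul, map_smul]
    refine Finset.sum_eq_zero fun p _ => ?_
    rw [hΛ]
    simp only [map_mul]
    rw [show ∑ i, w i * (eval (fun x => P x i) (koszul a b l m p.1) *
      eval (fun x => P x i) (koszul a b l m p.2)) = 0 from hwu p.1 p.2, smul_zero]

theorem MvPolynomial.eq_zero_of_eval_int_eq_zero {τ : Type*} {p : MvPolynomial τ ℤ}
    (s : τ → Set ℝ) (hs : ∀ i, (s i).Infinite)
    (h : ∀ x : τ → ℝ, (∀ i, x i ∈ s i) → eval₂Hom (Int.castRingHom ℝ) x p = 0) : p = 0 := by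
  apply map_injective (Int.castRingHom ℝ) Int.cast_injective
  refine funext_set s hs fun x hx => ?_
  rw [eval_map, map_zero, map_zero]
  exact h x fun i => hx i trivial

theorem eval₂Hom_det_productMatrix {τ S : Type*} [CommRing S] (x : τ → S)
    (α β : Sym2 (Fin 4) → τ) (l m : Sym2 (Fin 4))
    (γ : Exponents 4 → Sym2 (Fin 4) × Sym2 (Fin 4) → τ) :
    eval₂Hom (Int.castRingHom S) x
        (productMatrix (X ∘ α) (X ∘ β) l m fun i p => X (γ i p)).det =
      (productMatrix (x ∘ α) (x ∘ β) l m fun i p => x (γ i p)).det := by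
  rw [map_det_productMatrix]
  simp [Function.comp_def]

theorem det_productMatrix_eq_zero {K : Type*} [CommRing K] (a b : Sym2 (Fin 4) → K)
    (l m : Sym2 (Fin 4)) (c : Exponents 4 → Sym2 (Fin 4) × Sym2 (Fin 4) → K) :
    (productMatrix a b l m c).det = 0 := by
  let τ := Sym2 (Fin 4) ⊕ Sym2 (Fin 4) ⊕ Exponents 4 × Sym2 (Fin 4) × Sym2 (Fin 4)
  have hgen : (productMatrix (R := MvPolynomial τ ℤ) (X ∘ .inl) (X ∘ .inr ∘ .inl) l m
      fun i p => X (.inr (.inr (i, p)))).det = 0 := by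
    refine MvPolynomial.eq_zero_of_eval_int_eq_zero
      (Sum.elim (fun k => if k.IsDiag then Set.Ioi 3 else Set.Ioo (-1) 1) fun _ => Set.univ)
      ?_ fun x hx => ?_
    · rintro (k | k)
      · by_cases hk : k.IsDiag
        · simpa [hk] using Set.Ioi_infinite (3 : ℝ)
        · simpa [hk] using Set.Ioo_infinite (by norm_num : (-1 : ℝ) < 1)
      · exact Set.infinite_univ
    · rw [eval₂Hom_det_productMatrix]
      refine det_productMatrix_eq_zero_of_posDef _ _ _ _ _
        (posDef_of_three_lt_diag_of_abs_le_one ?_ ?_ ?_)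
      · ext i j
        simp [Sym2.eq_swap]
      · intro i
        simpa using hx (.inl s(i, i))
      · intro i j hij
        have : -1 < x (.inl s(i, j)) ∧ x (.inl s(i, j)) < 1 := by
          simpa [hij] using hx (.inl s(i, j))
        exact abs_le.2 ⟨this.1.le, this.2.le⟩
  have h := eval₂Hom_det_productMatrix (Sum.elim a (Sum.elim b fun q => c q.1 q.2)) .inl
    (.inr ∘ .inl) l m (fun i p => .inr (.inr (i, p)))
  exact h.symm.trans ((congrArg _ hgen).trans (map_zero _))

theorem not_homogeneousSubmodule_le_span_koszul_mul {K : Type*} [Field K] (a b : Sym2 (Fin 4) → K)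
    (l m : Sym2 (Fin 4)) :
    ¬ homogeneousSubmodule (Fin 4) K 4 ≤
      Submodule.span K (Set.range (koszul a b l m)) *
        Submodule.span K (Set.range (koszul a b l m)) := by
  intro h
  rw [Submodule.span_mul_span, ← Set.image2_mul, Set.image2_range] at h
  choose c hc using fun d : Exponents 4 => (Submodule.mem_span_range_iff_exists_fun K).1
    (h (isHomogeneous_monomial (1 : K) d.2))
  have h1 : productMatrix a b l m c = 1 := by
    ext i j
    simp only [productMatrix, Matrix.of_apply, ← smul_eq_C_mul]
    rw [hc i, coeff_monomial, Matrix.one_apply]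
    simp [Subtype.ext_iff]
  have h2 := det_productMatrix_eq_zero a b l m c
  rw [h1, Matrix.det_one] at h2
  exact one_ne_zero h2

theorem stmt_1 (K : Type*) [Field K]
    (W : Submodule K (MvPolynomial (Fin 4) K))
    (hW2 : W ≤ homogeneousSubmodule (Fin 4) K 2)
    (hdim : Module.finrank K ↥W = 8) :
    Module.finrank K ↥(W * W) ≤ 34 ∧
    Module.finrank K ↥(W * W) <
      min (Module.finrank K ↥(homogeneousSubmodule (Fin 4) K 4)) (Nat.choose 9 2) := by
  have h35 : Module.finrank K (homogeneousSubmodule (Fin 4) K 4) = 35 := by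
    rw [finrank_homogeneousSubmodule, Nat.multichoose_eq]
    rfl
  have : Module.Finite K (homogeneousSubmodule (Fin 4) K 4) :=
    Module.finite_of_finrank_pos (by omega)
  obtain ⟨a, b, l, m, hW⟩ := exists_le_span_koszul W hW2 hdim
  have hle : W * W ≤ homogeneousSubmodule (Fin 4) K 4 :=
    (mul_le_mul' hW2 hW2).trans (homogeneousSubmodule_mul 2 2)
  have hlt : Module.finrank K ↥(W * W) < 35 := by
    rw [← h35]
    refine Submodule.finrank_lt_finrank_of_lt (lt_of_le_not_ge hle fun h => ?_)
    exact not_homogeneousSubmodule_le_span_koszul_mul a b l m (h.trans (mul_le_mul' hW hW))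
  have h36 : Nat.choose 9 2 = 36 := rfl
  omega
end

section
/- Let K be a field with an element α ≠ 0, 1, and S = K[x1,x2,x3,x4]. Let W be the 8-dimensional subspace of S_2 spanned by the six squarefree monomials x_i x_j (1 ≤ i < j ≤ 4) together with F = x1^2 + x3^2 + x4^2 and G = x2^2 + α·x3^2 + x4^2. Then dim_K W^2 = 34. -/
open MvPolynomial

theorem finrank_homogeneousSubmodule_fin (K : Type*) [Field K] (m n : ℕ) :
    Module.finrank K (homogeneousSubmodule (Fin m) K n) = (m + n - 1).choose n := by
  have hS : homogeneousSubmodule (Fin m) K n =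
      restrictSupport K {d : Fin m →₀ ℕ | d.degree = n} :=
    homogeneousSubmodule_eq_finsupp_supported _ _ _
  have hset : {d : Fin m →₀ ℕ | d.degree = n} =
      ((Finset.univ : Finset (Fin m)).finsuppAntidiag n : Set (Fin m →₀ ℕ)) := by
    ext d
    simp [Finsupp.degree_eq_sum]
  rw [hS, hset, Module.finrank_eq_nat_card_basis (basisRestrictSupport K _),
    Nat.card_coe_set_eq, Set.ncard_coe_finset, Finset.card_finsuppAntidiag_nat_eq_choose,
    Finset.card_univ, Fintype.card_fin]

theorem homogeneousSubmodule_fin_four_le {K : Type*} [Field K] {n : ℕ}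
    {T : Submodule K (MvPolynomial (Fin 4) K)}
    (h : ∀ a b c d : ℕ, a + b + c + d = n →
      (X 0 ^ a * X 1 ^ b * X 2 ^ c * X 3 ^ d : MvPolynomial (Fin 4) K) ∈ T) :
    homogeneousSubmodule (Fin 4) K n ≤ T := by
  have hS : homogeneousSubmodule (Fin 4) K n =
      restrictSupport K {d : Fin 4 →₀ ℕ | d.degree = n} :=
    homogeneousSubmodule_eq_finsupp_supported _ _ _
  rw [hS, restrictSupport_eq_span, Submodule.span_le]
  rintro _ ⟨d, hd, rfl⟩
  have hd' : d 0 + d 1 + d 2 + d 3 = n := by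
    rw [← Fin.sum_univ_four (f := d), ← Finsupp.degree_eq_sum]
    exact hd
  have := h _ _ _ _ hd'
  simpa [monomial_eq, Finsupp.prod_fintype, Fin.prod_univ_four] using this

theorem isHomogeneous_X_mul_X {σ R : Type*} [CommSemiring R] (i j : σ) :
    (X i * X j : MvPolynomial σ R).IsHomogeneous 2 :=
  (isHomogeneous_X R i).mul (isHomogeneous_X R j)

/-- The combination `(α - 1) e₀ + (α - α²) e₁ + e₂ - α e₃` of the evaluations `eᵢ` at the standard
basis vectors. On quartic forms it only sees the coefficients of the fourth powers. -/
noncomputable def fourthPowerFunctional {K : Type*} [Field K] (α : K) :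
    MvPolynomial (Fin 4) K →ₗ[K] K :=
  let e (i : Fin 4) : MvPolynomial (Fin 4) K →ₗ[K] K := (aeval (Pi.single i (1 : K))).toLinearMap
  (α - 1) • e 0 + (α - α ^ 2) • e 1 + e 2 - α • e 3

theorem fourthPowerFunctional_mul {K : Type*} [Field K] (α : K) (f g : MvPolynomial (Fin 4) K) :
    fourthPowerFunctional α (f * g) =
      (α - 1) * (aeval (Pi.single 0 (1 : K)) f * aeval (Pi.single 0 (1 : K)) g) +
      (α - α ^ 2) * (aeval (Pi.single 1 (1 : K)) f * aeval (Pi.single 1 (1 : K)) g) +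
      aeval (Pi.single 2 (1 : K)) f * aeval (Pi.single 2 (1 : K)) g -
      α * (aeval (Pi.single 3 (1 : K)) f * aeval (Pi.single 3 (1 : K)) g) := by
  simp [fourthPowerFunctional]

theorem span_mul_span_le_ker_fourthPowerFunctional {K : Type*} [Field K] (α : K) :
    Submodule.span K
      ({ X 0 * X 1, X 0 * X 2, X 0 * X 3, X 1 * X 2, X 1 * X 3, X 2 * X 3,
         X 0 ^ 2 + X 2 ^ 2 + X 3 ^ 2,
         X 1 ^ 2 + C α * X 2 ^ 2 + X 3 ^ 2 } : Set (MvPolynomial (Fin 4) K)) *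
    Submodule.span K
      ({ X 0 * X 1, X 0 * X 2, X 0 * X 3, X 1 * X 2, X 1 * X 3, X 2 * X 3,
         X 0 ^ 2 + X 2 ^ 2 + X 3 ^ 2,
         X 1 ^ 2 + C α * X 2 ^ 2 + X 3 ^ 2 } : Set (MvPolynomial (Fin 4) K)) ≤
    LinearMap.ker (fourthPowerFunctional α) := by
  have hX {i j : Fin 4} (hij : i ≠ j) (k : Fin 4) :
      aeval (Pi.single k (1 : K)) (X i * X j : MvPolynomial (Fin 4) K) = 0 := by
    rw [map_mul, aeval_X, aeval_X, Pi.single_apply, Pi.single_apply]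
    split_ifs with hi hj
    · exact absurd (hi.trans hj.symm) hij
    all_goals simp
  have hgen {f : MvPolynomial (Fin 4) K} (hf : f ∈
      ({ X 0 * X 1, X 0 * X 2, X 0 * X 3, X 1 * X 2, X 1 * X 3, X 2 * X 3,
         X 0 ^ 2 + X 2 ^ 2 + X 3 ^ 2,
         X 1 ^ 2 + C α * X 2 ^ 2 + X 3 ^ 2 } : Set (MvPolynomial (Fin 4) K))) :
      (∀ k, aeval (Pi.single k (1 : K)) f = 0) ∨
        f = X 0 ^ 2 + X 2 ^ 2 + X 3 ^ 2 ∨ f = X 1 ^ 2 + C α * X 2 ^ 2 + X 3 ^ 2 := by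
    simp only [Set.mem_insert_iff, Set.mem_singleton_iff] at hf
    rcases hf with rfl | rfl | rfl | rfl | rfl | rfl | rfl | rfl
    iterate 6 exact Or.inl (hX (by decide))
    · exact Or.inr (Or.inl rfl)
    · exact Or.inr (Or.inr rfl)
  rw [Submodule.span_mul_span, Submodule.span_le]
  rintro _ ⟨f, hf, g, hg, rfl⟩
  rw [SetLike.mem_coe, LinearMap.mem_ker, fourthPowerFunctional_mul]
  rcases hgen hf with h | rfl | rfl
  · simp [h]
  all_goals
    rcases hgen hg with h | rfl | rfl
    · simp [h]
    all_goals
      simp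
      try ring

theorem homogeneousSubmodule_four_le_mul_sup_span {K : Type*} [Field K] {α : K}
    (h0 : α ≠ 0) (h1 : α ≠ 1) {W : Submodule K (MvPolynomial (Fin 4) K)}
    (hF : (X 0 ^ 2 + X 2 ^ 2 + X 3 ^ 2 : MvPolynomial (Fin 4) K) ∈ W)
    (hG : (X 1 ^ 2 + C α * X 2 ^ 2 + X 3 ^ 2 : MvPolynomial (Fin 4) K) ∈ W)
    (h01 : (X 0 * X 1 : MvPolynomial (Fin 4) K) ∈ W)
    (h02 : (X 0 * X 2 : MvPolynomial (Fin 4) K) ∈ W)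
    (h03 : (X 0 * X 3 : MvPolynomial (Fin 4) K) ∈ W)
    (h12 : (X 1 * X 2 : MvPolynomial (Fin 4) K) ∈ W)
    (h13 : (X 1 * X 3 : MvPolynomial (Fin 4) K) ∈ W)
    (h23 : (X 2 * X 3 : MvPolynomial (Fin 4) K) ∈ W) :
    homogeneousSubmodule (Fin 4) K 4 ≤
      W * W ⊔ Submodule.span K {(X 2 ^ 4 : MvPolynomial (Fin 4) K)} := by
  set T := W * W ⊔ Submodule.span K {(X 2 ^ 4 : MvPolynomial (Fin 4) K)}
  have hm {f g m : MvPolynomial (Fin 4) K} (hf : f ∈ W) (hg : g ∈ W) (h : m = f * g) :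
      m ∈ T := h ▸ Submodule.mem_sup_left (Submodule.mul_mem_mul hf hg)
  have m0040 : (X 2 ^ 4 : MvPolynomial (Fin 4) K) ∈ T :=
    Submodule.mem_sup_right (Submodule.mem_span_singleton_self _)
  clear_value T
  have m2200 : (X 0 ^ 2 * X 1 ^ 2 : MvPolynomial (Fin 4) K) ∈ T := hm h01 h01 (by ring)
  have m2020 : (X 0 ^ 2 * X 2 ^ 2 : MvPolynomial (Fin 4) K) ∈ T := hm h02 h02 (by ring)
  have m2002 : (X 0 ^ 2 * X 3 ^ 2 : MvPolynomial (Fin 4) K) ∈ T := hm h03 h03 (by ring)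
  have m0220 : (X 1 ^ 2 * X 2 ^ 2 : MvPolynomial (Fin 4) K) ∈ T := hm h12 h12 (by ring)
  have m0202 : (X 1 ^ 2 * X 3 ^ 2 : MvPolynomial (Fin 4) K) ∈ T := hm h13 h13 (by ring)
  have m0022 : (X 2 ^ 2 * X 3 ^ 2 : MvPolynomial (Fin 4) K) ∈ T := hm h23 h23 (by ring)
  have m2110 : (X 0 ^ 2 * X 1 * X 2 : MvPolynomial (Fin 4) K) ∈ T := hm h01 h02 (by ring)
  have m2101 : (X 0 ^ 2 * X 1 * X 3 : MvPolynomial (Fin 4) K) ∈ T := hm h01 h03 (by ring)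
  have m2011 : (X 0 ^ 2 * X 2 * X 3 : MvPolynomial (Fin 4) K) ∈ T := hm h02 h03 (by ring)
  have m1210 : (X 0 * X 1 ^ 2 * X 2 : MvPolynomial (Fin 4) K) ∈ T := hm h01 h12 (by ring)
  have m1201 : (X 0 * X 1 ^ 2 * X 3 : MvPolynomial (Fin 4) K) ∈ T := hm h01 h13 (by ring)
  have m0211 : (X 1 ^ 2 * X 2 * X 3 : MvPolynomial (Fin 4) K) ∈ T := hm h12 h13 (by ring)
  have m1120 : (X 0 * X 1 * X 2 ^ 2 : MvPolynomial (Fin 4) K) ∈ T := hm h02 h12 (by ring)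
  have m1021 : (X 0 * X 2 ^ 2 * X 3 : MvPolynomial (Fin 4) K) ∈ T := hm h02 h23 (by ring)
  have m0121 : (X 1 * X 2 ^ 2 * X 3 : MvPolynomial (Fin 4) K) ∈ T := hm h12 h23 (by ring)
  have m1102 : (X 0 * X 1 * X 3 ^ 2 : MvPolynomial (Fin 4) K) ∈ T := hm h03 h13 (by ring)
  have m1012 : (X 0 * X 2 * X 3 ^ 2 : MvPolynomial (Fin 4) K) ∈ T := hm h03 h23 (by ring)
  have m0112 : (X 1 * X 2 * X 3 ^ 2 : MvPolynomial (Fin 4) K) ∈ T := hm h13 h23 (by ring)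
  have m1111 : (X 0 * X 1 * X 2 * X 3 : MvPolynomial (Fin 4) K) ∈ T := hm h01 h23 (by ring)
  have m3100 : (X 0 ^ 3 * X 1 : MvPolynomial (Fin 4) K) ∈ T := by
    convert sub_mem (sub_mem (hm h01 hF rfl) m1120) m1102 using 1
    ring
  have m1300 : (X 0 * X 1 ^ 3 : MvPolynomial (Fin 4) K) ∈ T := by
    convert sub_mem (sub_mem (hm h01 hG rfl) (T.smul_mem α m1120)) m1102 using 1
    rw [smul_eq_C_mul]; ring
  have m1030 : (X 0 * X 2 ^ 3 : MvPolynomial (Fin 4) K) ∈ T := by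
    rw [← T.smul_mem_iff h0]
    convert sub_mem (sub_mem (hm h02 hG rfl) m1210) m1012 using 1
    rw [smul_eq_C_mul]; ring
  have m3010 : (X 0 ^ 3 * X 2 : MvPolynomial (Fin 4) K) ∈ T := by
    convert sub_mem (sub_mem (hm h02 hF rfl) m1030) m1012 using 1
    ring
  have m1003 : (X 0 * X 3 ^ 3 : MvPolynomial (Fin 4) K) ∈ T := by
    convert sub_mem (sub_mem (hm h03 hG rfl) m1201) (T.smul_mem α m1021) using 1
    rw [smul_eq_C_mul]; ring
  have m3001 : (X 0 ^ 3 * X 3 : MvPolynomial (Fin 4) K) ∈ T := by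
    convert sub_mem (sub_mem (hm h03 hF rfl) m1021) m1003 using 1
    ring
  have m0130 : (X 1 * X 2 ^ 3 : MvPolynomial (Fin 4) K) ∈ T := by
    convert sub_mem (sub_mem (hm h12 hF rfl) m2110) m0112 using 1
    ring
  have m0310 : (X 1 ^ 3 * X 2 : MvPolynomial (Fin 4) K) ∈ T := by
    convert sub_mem (sub_mem (hm h12 hG rfl) (T.smul_mem α m0130)) m0112 using 1
    rw [smul_eq_C_mul]; ring
  have m0103 : (X 1 * X 3 ^ 3 : MvPolynomial (Fin 4) K) ∈ T := by
    convert sub_mem (sub_mem (hm h13 hF rfl) m2101) m0121 using 1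
    ring
  have m0301 : (X 1 ^ 3 * X 3 : MvPolynomial (Fin 4) K) ∈ T := by
    convert sub_mem (sub_mem (hm h13 hG rfl) (T.smul_mem α m0121)) m0103 using 1
    rw [smul_eq_C_mul]; ring
  have m0031 : (X 2 ^ 3 * X 3 : MvPolynomial (Fin 4) K) ∈ T := by
    rw [← T.smul_mem_iff (sub_ne_zero.2 h1.symm)]
    convert add_mem (sub_mem (sub_mem (hm h23 hF rfl) (hm h23 hG rfl)) m2011) m0211 using 1
    rw [smul_eq_C_mul, C_sub, C_1]; ring
  have m0013 : (X 2 * X 3 ^ 3 : MvPolynomial (Fin 4) K) ∈ T := by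
    convert sub_mem (sub_mem (hm h23 hF rfl) m2011) m0031 using 1
    ring
  have m0004 : (X 3 ^ 4 : MvPolynomial (Fin 4) K) ∈ T := by
    convert sub_mem (sub_mem (sub_mem (sub_mem (sub_mem (sub_mem (hm hF hG rfl) m2200)
      (T.smul_mem α m2020)) m2002) (add_mem m0220 m0202)) (T.smul_mem (1 + α) m0022))
      (T.smul_mem α m0040) using 1
    simp only [smul_eq_C_mul, C_add, C_1]; ring
  have m4000 : (X 0 ^ 4 : MvPolynomial (Fin 4) K) ∈ T := by
    convert sub_mem (sub_mem (sub_mem (hm hF hF rfl) (T.smul_mem 2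
      (add_mem (add_mem m2020 m2002) m0022))) m0040) m0004 using 1
    rw [ofNat_smul_eq_nsmul]; ring
  have m0400 : (X 1 ^ 4 : MvPolynomial (Fin 4) K) ∈ T := by
    convert sub_mem (sub_mem (sub_mem (hm hG hG rfl) (T.smul_mem 2
      (add_mem (add_mem (T.smul_mem α m0220) m0202) (T.smul_mem α m0022))))
      (T.smul_mem (α ^ 2) m0040)) m0004 using 1
    simp only [ofNat_smul_eq_nsmul, smul_eq_C_mul, C_pow]; ring
  apply homogeneousSubmodule_fin_four_le
  intro a b c d h
  have ha : a ≤ 4 := by omega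
  have hb : b ≤ 4 := by omega
  have hc : c ≤ 4 := by omega
  obtain rfl : d = 4 - a - b - c := by omega
  interval_cases a <;> interval_cases b <;> interval_cases c <;>
    first
    | omega
    | simp only [pow_zero, pow_one, one_mul, mul_one, Nat.reduceSub]
      with_reducible assumption

theorem stmt_3 (K : Type*) [Field K] (α : K) (h0 : α ≠ 0) (h1 : α ≠ 1)
    (W : Submodule K (MvPolynomial (Fin 4) K))
    (hW : W = Submodule.span K
      ({ X 0 * X 1, X 0 * X 2, X 0 * X 3, X 1 * X 2, X 1 * X 3, X 2 * X 3,
         X 0 ^ 2 + X 2 ^ 2 + X 3 ^ 2,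
         X 1 ^ 2 + C α * X 2 ^ 2 + X 3 ^ 2 } : Set (MvPolynomial (Fin 4) K))) :
    Module.finrank K ↥W = 8 ∧ Module.finrank K ↥(W * W) = 34 := by
  have hF : (X 0 ^ 2 + X 2 ^ 2 + X 3 ^ 2 : MvPolynomial (Fin 4) K) ∈ W := by
    rw [hW]; exact Submodule.subset_span (by simp)
  have hG : (X 1 ^ 2 + C α * X 2 ^ 2 + X 3 ^ 2 : MvPolynomial (Fin 4) K) ∈ W := by
    rw [hW]; exact Submodule.subset_span (by simp)
  have h01 : (X 0 * X 1 : MvPolynomial (Fin 4) K) ∈ W := by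
    rw [hW]; exact Submodule.subset_span (by simp)
  have h02 : (X 0 * X 2 : MvPolynomial (Fin 4) K) ∈ W := by
    rw [hW]; exact Submodule.subset_span (by simp)
  have h03 : (X 0 * X 3 : MvPolynomial (Fin 4) K) ∈ W := by
    rw [hW]; exact Submodule.subset_span (by simp)
  have h12 : (X 1 * X 2 : MvPolynomial (Fin 4) K) ∈ W := by
    rw [hW]; exact Submodule.subset_span (by simp)
  have h13 : (X 1 * X 3 : MvPolynomial (Fin 4) K) ∈ W := by
    rw [hW]; exact Submodule.subset_span (by simp)
  have h23 : (X 2 * X 3 : MvPolynomial (Fin 4) K) ∈ W := by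
    rw [hW]; exact Submodule.subset_span (by simp)
  have hWS : W ≤ homogeneousSubmodule (Fin 4) K 2 := by
    have hX (i : Fin 4) : (X i ^ 2 : MvPolynomial (Fin 4) K).IsHomogeneous 2 :=
      isHomogeneous_X_pow i 2
    have hC : (C α * X 2 ^ 2 : MvPolynomial (Fin 4) K).IsHomogeneous 2 := (hX 2).C_mul α
    rw [hW, Submodule.span_le]
    rintro f hf
    simp only [Set.mem_insert_iff, Set.mem_singleton_iff] at hf
    rcases hf with rfl | rfl | rfl | rfl | rfl | rfl | rfl | rfl
    iterate 6 exact isHomogeneous_X_mul_X _ _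
    · exact ((hX 0).add (hX 2)).add (hX 3)
    · exact ((hX 1).add hC).add (hX 3)
  have hfin (n : ℕ) : Module.Finite K (homogeneousSubmodule (Fin 4) K n) :=
    Module.Finite.iff_fg.2 (homogeneousSubmodule_fg _ _ n)
  have hWfin : Module.Finite K W := Submodule.finiteDimensional_of_le hWS
  constructor
  · apply le_antisymm
    · classical
      let s : Finset (MvPolynomial (Fin 4) K) :=
        { X 0 * X 1, X 0 * X 2, X 0 * X 3, X 1 * X 2, X 1 * X 3, X 2 * X 3,
          X 0 ^ 2 + X 2 ^ 2 + X 3 ^ 2, X 1 ^ 2 + C α * X 2 ^ 2 + X 3 ^ 2 }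
      have hs : W = Submodule.span K (s : Set (MvPolynomial (Fin 4) K)) := by
        rw [hW]; simp [s]
      rw [hs]
      exact (finrank_span_finset_le_card s).trans <| (Finset.card_insert_le _ _).trans <|
        Nat.succ_le_succ <| (Finset.card_insert_le _ _).trans <|
        Nat.succ_le_succ Finset.card_le_six
    · classical
      let q : Finset (MvPolynomial (Fin 4) K) := {X 2 ^ 2, X 3 ^ 2}
      let Q := Submodule.span K (q : Set (MvPolynomial (Fin 4) K))
      have h2 : (X 2 ^ 2 : MvPolynomial (Fin 4) K) ∈ Q := Submodule.subset_span (by simp [q])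
      have h3 : (X 3 ^ 2 : MvPolynomial (Fin 4) K) ∈ Q := Submodule.subset_span (by simp [q])
      have hle : homogeneousSubmodule (Fin 4) K 2 ≤ W ⊔ Q := by
        have hl {f : MvPolynomial (Fin 4) K} (hf : f ∈ W) : f ∈ W ⊔ Q :=
          Submodule.mem_sup_left hf
        have k2 : (X 2 ^ 2 : MvPolynomial (Fin 4) K) ∈ W ⊔ Q := Submodule.mem_sup_right h2
        have k3 : (X 3 ^ 2 : MvPolynomial (Fin 4) K) ∈ W ⊔ Q := Submodule.mem_sup_right h3
        have k0 : (X 0 ^ 2 : MvPolynomial (Fin 4) K) ∈ W ⊔ Q := by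
          convert sub_mem (sub_mem (hl hF) k2) k3 using 1
          ring
        have k1 : (X 1 ^ 2 : MvPolynomial (Fin 4) K) ∈ W ⊔ Q := by
          convert sub_mem (sub_mem (hl hG) (Submodule.smul_mem _ α k2)) k3 using 1
          rw [smul_eq_C_mul]; ring
        have := hl h01
        have := hl h02
        have := hl h03
        have := hl h12
        have := hl h13
        have := hl h23
        apply homogeneousSubmodule_fin_four_le
        intro a b c d h
        have ha : a ≤ 2 := by omega
        have hb : b ≤ 2 := by omega
        have hc : c ≤ 2 := by omega
        obtain rfl : d = 2 - a - b - c := by omega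
        interval_cases a <;> interval_cases b <;> interval_cases c <;>
          first | omega | simpa
      have hdim := (Submodule.finrank_mono hle).trans
        (Submodule.finrank_add_le_finrank_add_finrank W Q)
      have hQ : Module.finrank K Q ≤ 2 :=
        (finrank_span_finset_le_card q).trans Finset.card_le_two
      rw [finrank_homogeneousSubmodule_fin] at hdim
      norm_num [Nat.choose] at hdim
      omega
  · have hPS : W * W ≤ homogeneousSubmodule (Fin 4) K 4 :=
      (mul_le_mul' hWS hWS).trans (homogeneousSubmodule_mul 2 2)
    have hPfin : Module.Finite K ↥(W * W) := Submodule.finiteDimensional_of_le hPS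
    let φ := fourthPowerFunctional α
    have hPφ : W * W ≤ LinearMap.ker φ := hW ▸ span_mul_span_le_ker_fourthPowerFunctional α
    have hX4 : (X 2 ^ 4 : MvPolynomial (Fin 4) K) ∉ W * W := by
      intro h
      have := hPφ h
      simp [φ, fourthPowerFunctional] at this
    have hlt : W * W < homogeneousSubmodule (Fin 4) K 4 :=
      lt_of_le_of_ne hPS fun h => hX4 (h ▸ isHomogeneous_X_pow 2 4)
    have hupper := Submodule.finrank_lt_finrank_of_lt hlt
    let Q := Submodule.span K {(X 2 ^ 4 : MvPolynomial (Fin 4) K)}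
    have hle : homogeneousSubmodule (Fin 4) K 4 ≤ W * W ⊔ Q :=
      homogeneousSubmodule_four_le_mul_sup_span h0 h1 hF hG h01 h02 h03 h12 h13 h23
    have hdim := (Submodule.finrank_mono hle).trans
      (Submodule.finrank_add_le_finrank_add_finrank (W * W) Q)
    have hQ : Module.finrank K Q ≤ 1 :=
      (finrank_span_singleton (pow_ne_zero 4 (X_ne_zero 2))).le
    rw [finrank_homogeneousSubmodule_fin] at hdim hupper
    norm_num [Nat.choose] at hdim hupper
    omega
end

section
/- Let K be a field and S = K[x,y,z]. Let W = span of {xy^2z, xy^3, x^2yz, x^2y^2, x^3z, x^3y, x^4} (the strongly stable space generated by xy^2z). Then for every 7-dimensional monomial subspace V of S_4 that is strongly stable, dim W^2 ≤ dim V^2; in particular dim W^2 ≤ 18 = dim(Lex)^2 and dim W^2 ≤ dim(RevLex)^2 where RevLex = span{y^4, xy^3, x^2yz, x^2y^2, x^3z, x^3y, x^4}. -/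
open MvPolynomial

/-- A set of exponent vectors is strongly stable (w.r.t. the variable order
`x_0 > x_1 > …`) if it is closed under the exchanges `m ↦ m * x_i / x_j` for `i < j`
whenever `x_j` divides `m`. -/
def StronglyStableSet {n : ℕ} (M : Set (Fin n →₀ ℕ)) : Prop :=
  ∀ m ∈ M, ∀ i j : Fin n, i < j → m j ≠ 0 →
    (m + Finsupp.single i 1 - Finsupp.single j 1) ∈ M

/-- A strongly stable monomial subspace: the span of the monomials with exponents in some
strongly stable set. -/
def IsStronglyStableSubspace {n : ℕ} (K : Type*) [Field K]
    (W : Submodule K (MvPolynomial (Fin n) K)) : Prop :=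
  ∃ M : Set (Fin n →₀ ℕ), StronglyStableSet M ∧
    W = Submodule.span K ((fun m => (monomial m 1 : MvPolynomial (Fin n) K)) '' M)

open scoped Pointwise

section MonomialSpan

variable (K : Type*) [Field K] {σ : Type*}

/-- The span of the monomials with exponents in `M`. -/
noncomputable def monomialSpan (M : Set (σ →₀ ℕ)) : Submodule K (MvPolynomial σ K) :=
  Submodule.span K ((fun m => (monomial m 1 : MvPolynomial σ K)) '' M)

theorem finrank_monomialSpan (M : Set (σ →₀ ℕ)) :
    Module.finrank K (monomialSpan K M) = M.ncard := by
  have hli : LinearIndependent K (fun m : σ →₀ ℕ => (monomial m 1 : MvPolynomial σ K)) := by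
    simpa using (basisMonomials σ K).linearIndependent
  have hM := (hli.linearIndepOn_id.mono (Set.image_subset_range _ M))
  rw [monomialSpan, Module.finrank, rank_span_set hM, ← Set.ncard_image_of_injective M hli.injective]
  rfl

theorem monomialSpan_mul (M N : Set (σ →₀ ℕ)) :
    monomialSpan K M * monomialSpan K N = monomialSpan K (M + N) := by
  rw [monomialSpan, monomialSpan, Submodule.span_mul_span, monomialSpan]
  congr 1
  ext p
  simp [Set.mem_mul, Set.mem_add, monomial_mul]

theorem degree_eq_of_monomialSpan_le {M : Set (σ →₀ ℕ)} {d : ℕ}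
    (h : monomialSpan K M ≤ homogeneousSubmodule σ K d) {m : σ →₀ ℕ} (hm : m ∈ M) :
    m.degree = d := by
  have := h (Submodule.subset_span ⟨m, hm, rfl⟩)
  rw [mem_homogeneousSubmodule] at this
  by_contra hne
  have h1 := this.coeff_eq_zero (d := m) hne
  classical simp [coeff_monomial] at h1

end MonomialSpan

/-- The exponents of the second and third variables, which determine an exponent vector of
known degree. -/
def exponentTail : (Fin 3 →₀ ℕ) →+ ℕ × ℕ where
  toFun m := (m 1, m 2)
  map_zero' := rfl
  map_add' _ _ := rfl

theorem exponentTail_apply (m : Fin 3 →₀ ℕ) : exponentTail m = (m 1, m 2) := rfl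

theorem exponentTail_injOn (d : ℕ) : Set.InjOn exponentTail {m | m.degree = d} := by
  intro a ha b hb hab
  simp only [Set.mem_ofPred_eq, Finsupp.degree_eq_sum, Fin.sum_univ_three] at ha hb
  simp only [exponentTail_apply, Prod.mk.injEq] at hab
  ext i
  fin_cases i <;> simp <;> omega

theorem finrank_monomialSpan_of_degree (K : Type*) [Field K] {M : Set (Fin 3 →₀ ℕ)} {d : ℕ}
    (hM : ∀ m ∈ M, m.degree = d) {T : Finset (ℕ × ℕ)} (hT : exponentTail '' M = T) :
    Module.finrank K (monomialSpan K M) = T.card := by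
  rw [finrank_monomialSpan, ← Set.ncard_coe_finset T, ← hT]
  exact ((exponentTail_injOn d).mono hM).ncard_image.symm

theorem finrank_monomialSpan_mul_self (K : Type*) [Field K] {M : Set (Fin 3 →₀ ℕ)} {d : ℕ}
    (hM : ∀ m ∈ M, m.degree = d) {T : Finset (ℕ × ℕ)} (hT : exponentTail '' M = T) :
    Module.finrank K ↥(monomialSpan K M * monomialSpan K M) = (T + T).card := by
  rw [monomialSpan_mul]
  apply finrank_monomialSpan_of_degree K (d := d + d)
  · rintro _ ⟨a, ha, b, hb, rfl⟩
    simp [hM a ha, hM b hb]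
  · rw [Set.image_add, hT, Finset.coe_add]

/-- The exponent vector of `x^i y^j z^k`. -/
noncomputable def ternaryExponent (i j k : ℕ) : Fin 3 →₀ ℕ :=
  Finsupp.single 0 i + Finsupp.single 1 j + Finsupp.single 2 k

theorem monomial_ternaryExponent (K : Type*) [Field K] (i j k : ℕ) :
    (monomial (ternaryExponent i j k) 1 : MvPolynomial (Fin 3) K) = X 0 ^ i * X 1 ^ j * X 2 ^ k := by
  simp [ternaryExponent, X_pow_eq_monomial, monomial_mul]

theorem exponentTail_ternaryExponent (i j k : ℕ) :
    exponentTail (ternaryExponent i j k) = (j, k) := by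
  simp [exponentTail_apply, ternaryExponent]

theorem degree_ternaryExponent (i j k : ℕ) : (ternaryExponent i j k).degree = i + j + k := by
  simp [ternaryExponent]

/-- The tails of the exponents of the strongly stable space generated by `x y^2 z`. -/
def principalTails : Finset (ℕ × ℕ) := {(2, 1), (3, 0), (1, 1), (2, 0), (0, 1), (1, 0), (0, 0)}

/-- The tails of the exponents of the reverse lexicographic segment of size seven. -/
def revLexTails : Finset (ℕ × ℕ) := {(4, 0), (3, 0), (1, 1), (2, 0), (0, 1), (1, 0), (0, 0)}

/-- The tails of the exponents of the lexicographic segment of size seven. -/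
def lexTails : Finset (ℕ × ℕ) := {(3, 0), (0, 2), (1, 1), (2, 0), (0, 1), (1, 0), (0, 0)}

theorem lex_or_principal_or_revLex_subset {T : Finset (ℕ × ℕ)}
    (hdeg : ∀ p ∈ T, p.1 + p.2 ≤ 4)
    (hyx : ∀ y z, (y + 1, z) ∈ T → (y, z) ∈ T)
    (hzy : ∀ y z, (y, z + 1) ∈ T → (y + 1, z) ∈ T) (hcard : 7 ≤ T.card) :
    lexTails ⊆ T ∨ principalTails ⊆ T ∨ revLexTails ⊆ T := by
  have hle : ∀ U : Finset (ℕ × ℕ), T ⊆ U → 7 ≤ U.card :=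
    fun U h => hcard.trans (Finset.card_le_card h)
  have y00 := hyx 0 0
  have y10 := hyx 1 0
  have y20 := hyx 2 0
  have y30 := hyx 3 0
  have y01 := hyx 0 1
  have y11 := hyx 1 1
  have y21 := hyx 2 1
  have y02 := hyx 0 2
  have y12 := hyx 1 2
  have y03 := hyx 0 3
  have z00 := hzy 0 0
  have z10 := hzy 1 0
  have z20 := hzy 2 0
  have z30 := hzy 3 0
  have z01 := hzy 0 1
  have z11 := hzy 1 1
  have z21 := hzy 2 1
  have z02 := hzy 0 2
  have z12 := hzy 1 2
  have z03 := hzy 0 3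
  norm_num at y00 y10 y20 y30 y01 y11 y21 y02 y12 y03 z00 z10 z20 z30 z01 z11 z21 z02 z12 z03
  have hsub : ∀ U : Finset (ℕ × ℕ),
      (∀ y ∈ Finset.range 5, ∀ z ∈ Finset.range 5, y + z ≤ 4 → (y, z) ∉ U → (y, z) ∉ T) → T ⊆ U := by
    intro U hU p hp
    by_contra hpU
    have := hdeg p hp
    exact hU p.1 (by rw [Finset.mem_range]; omega) p.2 (by rw [Finset.mem_range]; omega) this hpU hp
  by_cases h21 : (2, 1) ∈ T
  · right; left
    simp only [principalTails, Finset.insert_subset_iff, Finset.singleton_subset_iff]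
    grind
  by_cases h11 : (1, 1) ∈ T ∧ (4, 0) ∈ T
  · right; right
    simp only [revLexTails, Finset.insert_subset_iff, Finset.singleton_subset_iff]
    grind
  by_cases h02 : (0, 2) ∈ T ∧ (3, 0) ∈ T
  · left
    simp only [lexTails, Finset.insert_subset_iff, Finset.singleton_subset_iff]
    grind
  exfalso
  by_cases g02 : (0, 2) ∈ T
  · have := hle {(0, 0), (1, 0), (2, 0), (0, 1), (1, 1), (0, 2)} (hsub _ (by
      simp [Finset.range_add_one]
      grind))
    simp at this
  by_cases g11 : (1, 1) ∈ T
  · have := hle {(0, 0), (1, 0), (2, 0), (3, 0), (0, 1), (1, 1)} (hsub _ (by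
      simp [Finset.range_add_one]
      grind))
    simp at this
  · have := hle {(0, 0), (1, 0), (2, 0), (3, 0), (4, 0), (0, 1)} (hsub _ (by
      simp [Finset.range_add_one]
      grind))
    simp at this

theorem StronglyStableSet.exponentTail_shift_y {M : Set (Fin 3 →₀ ℕ)} (hM : StronglyStableSet M)
    {y z : ℕ} (h : (y + 1, z) ∈ exponentTail '' M) : (y, z) ∈ exponentTail '' M := by
  obtain ⟨m, hm, hmt⟩ := h
  simp only [exponentTail_apply, Prod.mk.injEq] at hmt
  refine ⟨_, hM m hm 0 1 (by decide) (by omega), ?_⟩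
  simp [exponentTail_apply, hmt]

theorem StronglyStableSet.exponentTail_shift_z {M : Set (Fin 3 →₀ ℕ)} (hM : StronglyStableSet M)
    {y z : ℕ} (h : (y, z + 1) ∈ exponentTail '' M) : (y + 1, z) ∈ exponentTail '' M := by
  obtain ⟨m, hm, hmt⟩ := h
  simp only [exponentTail_apply, Prod.mk.injEq] at hmt
  refine ⟨_, hM m hm 1 2 (by decide) (by omega), ?_⟩
  simp [exponentTail_apply, hmt]

theorem card_principalTails_add : (principalTails + principalTails).card = 18 := by decide

theorem card_revLexTails_add : (revLexTails + revLexTails).card = 18 := by decide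

theorem card_lexTails_add : (lexTails + lexTails).card = 19 := by decide

theorem le_finrank_mul_self_of_stronglyStable (K : Type*) [Field K]
    {V : Submodule K (MvPolynomial (Fin 3) K)} (hV : IsStronglyStableSubspace K V)
    (hdeg : V ≤ homogeneousSubmodule (Fin 3) K 4) (hrank : Module.finrank K V = 7) :
    18 ≤ Module.finrank K ↥(V * V) := by
  obtain ⟨M, hM, rfl⟩ := hV
  change Module.finrank K (monomialSpan K M) = 7 at hrank
  change 18 ≤ Module.finrank K ↥(monomialSpan K M * monomialSpan K M)
  have hd : ∀ m ∈ M, m.degree = 4 := fun m hm => degree_eq_of_monomialSpan_le K hdeg hm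
  have hfin : M.Finite := by
    apply Set.finite_of_ncard_ne_zero
    rw [← finrank_monomialSpan K M, hrank]
    decide
  obtain ⟨T, hT⟩ := (hfin.image exponentTail).exists_finset_coe
  have hcard := finrank_monomialSpan_of_degree K hd hT.symm
  rw [finrank_monomialSpan_mul_self K hd hT.symm]
  have hmem : ∀ p, p ∈ T ↔ p ∈ exponentTail '' M := fun p => by rw [← hT, Finset.mem_coe]
  have hcases := lex_or_principal_or_revLex_subset (T := T)
    (by
      intro p hp
      obtain ⟨m, hm, rfl⟩ := (hmem p).1 hp
      have := hd m hm
      rw [Finsupp.degree_eq_sum, Fin.sum_univ_three] at this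
      simp only [exponentTail_apply]
      omega)
    (fun y z h => (hmem _).2 (hM.exponentTail_shift_y ((hmem _).1 h)))
    (fun y z h => (hmem _).2 (hM.exponentTail_shift_z ((hmem _).1 h)))
    (by omega)
  rcases hcases with h | h | h
  · have := Finset.card_le_card (Finset.add_subset_add h h)
    rw [card_lexTails_add] at this
    omega
  · exact card_principalTails_add.ge.trans (Finset.card_le_card (Finset.add_subset_add h h))
  · exact card_revLexTails_add.ge.trans (Finset.card_le_card (Finset.add_subset_add h h))

theorem stmt_9 (K : Type*) [Field K]
    (W RevLex : Submodule K (MvPolynomial (Fin 3) K))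
    (hW : W = Submodule.span K
      ({ X 0 * X 1 ^ 2 * X 2, X 0 * X 1 ^ 3, X 0 ^ 2 * X 1 * X 2, X 0 ^ 2 * X 1 ^ 2,
         X 0 ^ 3 * X 2, X 0 ^ 3 * X 1, X 0 ^ 4 } : Set (MvPolynomial (Fin 3) K)))
    (hRevLex : RevLex = Submodule.span K
      ({ X 1 ^ 4, X 0 * X 1 ^ 3, X 0 ^ 2 * X 1 * X 2, X 0 ^ 2 * X 1 ^ 2,
         X 0 ^ 3 * X 2, X 0 ^ 3 * X 1, X 0 ^ 4 } : Set (MvPolynomial (Fin 3) K))) :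
    (∀ V : Submodule K (MvPolynomial (Fin 3) K),
      IsStronglyStableSubspace K V → V ≤ homogeneousSubmodule (Fin 3) K 4 →
      Module.finrank K ↥V = 7 →
      Module.finrank K ↥(W * W) ≤ Module.finrank K ↥(V * V)) ∧
    Module.finrank K ↥(W * W) ≤ 18 ∧
    Module.finrank K ↥(W * W) ≤ Module.finrank K ↥(RevLex * RevLex) := by
  have hW' : W = monomialSpan K {ternaryExponent 1 2 1, ternaryExponent 1 3 0,
      ternaryExponent 2 1 1, ternaryExponent 2 2 0, ternaryExponent 3 0 1,
      ternaryExponent 3 1 0, ternaryExponent 4 0 0} := by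
    simp [hW, monomialSpan, Set.image_insert_eq, monomial_ternaryExponent]
  have hR' : RevLex = monomialSpan K {ternaryExponent 0 4 0, ternaryExponent 1 3 0,
      ternaryExponent 2 1 1, ternaryExponent 2 2 0, ternaryExponent 3 0 1,
      ternaryExponent 3 1 0, ternaryExponent 4 0 0} := by
    simp [hRevLex, monomialSpan, Set.image_insert_eq, monomial_ternaryExponent]
  have hWrank : Module.finrank K ↥(W * W) = 18 := by
    rw [hW', finrank_monomialSpan_mul_self K (d := 4) (T := principalTails)
      (by simp [degree_ternaryExponent])
      (by simp [Set.image_insert_eq, exponentTail_ternaryExponent, principalTails]),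
      card_principalTails_add]
  have hRrank : Module.finrank K ↥(RevLex * RevLex) = 18 := by
    rw [hR', finrank_monomialSpan_mul_self K (d := 4) (T := revLexTails)
      (by simp [degree_ternaryExponent])
      (by simp [Set.image_insert_eq, exponentTail_ternaryExponent, revLexTails]),
      card_revLexTails_add]
  rw [hWrank, hRrank]
  exact ⟨fun V hV hdeg hrank => le_finrank_mul_self_of_stronglyStable K hV hdeg hrank,
    le_rfl, le_rfl⟩
end
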